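/- Let R be an extension of a non-trivial finite group G by T = {t₁, t₂} such that G^l_t = G for every t ∈ T and t₁, t₂ are not self-dual (hence t̄₁ = t₂). Then there exist a, b ∈ ℕ with t₁ × t₁ = a t₁ + b t₂, t₂ × t₂ = b t₁ + a t₂, t₁ × t₂ = t₂ × t₁ = ∑_{g∈G} g + a t₁ + a t₂, and these satisfy b² − a² = |G|. -/

import Mathlib

/-- A fusion ring, given by its finite basis `B`, unit, involution (dual) and
structure constants `N a b c` (the coefficient of `c` in `a × b`). -/
structure FusionData (B : Type*) [Fintype B] [DecidableEq B] where
  one : B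
  dual : B → B
  N : B → B → B → ℕ
  dual_dual : ∀ a, dual (dual a) = a
  N_one_left : ∀ a c, N one a c = if a = c then 1 else 0
  N_one_right : ∀ a c, N a one c = if a = c then 1 else 0
  assoc : ∀ a b c d, ∑ e, N a b e * N e c d = ∑ f, N b c f * N a f d
  dual_pair : ∀ a b, N a (dual b) one = if a = b then 1 else 0
  frob : ∀ a b c, N a b c = N (dual a) c b

/-- An extension of a finite group `G` by a finite set `T`: a fusion ring with
basis `G ⊔ T`, unit `1 ∈ G`, whose structure constants restrict to the group
multiplication on `G`. -/
structure GroupExt (G T : Type*) [Group G] [Fintype G] [DecidableEq G]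
    [Fintype T] [DecidableEq T] extends FusionData (G ⊕ T) where
  one_def : one = Sum.inl 1
  mul_def : ∀ g h k : G, N (Sum.inl g) (Sum.inl h) (Sum.inl k) = if g * h = k then 1 else 0
  mul_t : ∀ (g h : G) (t : T), N (Sum.inl g) (Sum.inl h) (Sum.inr t) = 0

namespace FusionData

variable {B : Type*} [Fintype B] [DecidableEq B] (R : FusionData B)

theorem N_one (a b : B) : R.N a b R.one = if b = R.dual a then 1 else 0 := by
  have h := R.dual_pair a (R.dual b)
  rw [R.dual_dual] at h
  rw [h]
  refine if_congr ⟨fun h => ?_, fun h => ?_⟩ rfl rfl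
  · rw [h, R.dual_dual]
  · rw [h, R.dual_dual]

theorem N_cyclic (a b c : B) : R.N a b (R.dual c) = R.N b c (R.dual a) := by
  have h := R.assoc a b c R.one
  have hd (e : B) : c = R.dual e ↔ e = R.dual c :=
    ⟨fun h => by rw [h, R.dual_dual], fun h => by rw [h, R.dual_dual]⟩
  simpa [N_one, hd] using h

end FusionData

namespace GroupExt

variable {G T : Type*} [Group G] [Fintype G] [DecidableEq G] [Fintype T] [DecidableEq T]
  (E : GroupExt G T)

theorem dual_inl (g : G) : E.dual (Sum.inl g) = Sum.inl g⁻¹ := by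
  have h := E.N_one (Sum.inl g) (Sum.inl g⁻¹)
  rw [E.one_def, E.mul_def] at h
  by_contra hne
  simp [Ne.symm hne] at h

theorem N_inl_inr_inl (g h : G) (t : T) : E.N (Sum.inl g) (Sum.inr t) (Sum.inl h) = 0 := by
  rw [E.frob, dual_inl, E.mul_t]

theorem sum_N_inl_inr (g : G) (x y : T) :
    ∑ z : T, E.N (Sum.inl g) (Sum.inr x) (Sum.inr z) * E.N (Sum.inl g⁻¹) (Sum.inr z) (Sum.inr y) =
      if x = y then 1 else 0 := by
  have h := E.assoc (Sum.inl g⁻¹) (Sum.inl g) (Sum.inr x) (Sum.inr y)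
  have h1 := E.N_one_left (Sum.inr x) (Sum.inr y)
  rw [E.one_def] at h1
  simp only [Fintype.sum_sum_type, E.mul_def, E.mul_t, N_inl_inr_inl, zero_mul,
    Finset.sum_const_zero, zero_add, add_zero, inv_mul_cancel, ite_mul, one_mul,
    Finset.sum_ite_eq, Finset.mem_univ, if_true] at h
  rw [← h, h1]
  simp

/-- If every `g ∈ G` fixes every `t ∈ T`, then `g × t = t`. -/
theorem N_inl_inr_inr
    (hstab : ∀ (g : G) (t : T), E.N (Sum.inl g) (Sum.inr t) (Sum.inr t) ≠ 0) (g : G) (x y : T) :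
    E.N (Sum.inl g) (Sum.inr x) (Sum.inr y) = if x = y then 1 else 0 := by
  have h := E.sum_N_inl_inr g x y
  have hle := Finset.single_le_sum (f := fun z : T =>
    E.N (Sum.inl g) (Sum.inr x) (Sum.inr z) * E.N (Sum.inl g⁻¹) (Sum.inr z) (Sum.inr y))
    (fun _ _ => Nat.zero_le _) (Finset.mem_univ y)
  rw [h] at hle
  have hpos := Nat.pos_of_ne_zero (hstab g⁻¹ y)
  have hmul := (Nat.le_mul_of_pos_right _ hpos).trans hle
  split_ifs at hmul ⊢ with hxy
  · subst hxy
    exact le_antisymm hmul (Nat.pos_of_ne_zero (hstab g x))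
  · exact Nat.le_zero.mp hmul

/-- If `G` fixes every `t ∈ T` and `ȳ = z`, then the multiplicity of `g` in `x × y` is
`1` when `x = z` and `0` otherwise. -/
theorem N_inr_inr_inl
    (hstab : ∀ (g : G) (t : T), E.N (Sum.inl g) (Sum.inr t) (Sum.inr t) ≠ 0) (g : G) {x y z : T}
    (hyz : E.dual (Sum.inr y) = Sum.inr z) :
    E.N (Sum.inr x) (Sum.inr y) (Sum.inl g) = if x = z then 1 else 0 := by
  have h := E.N_cyclic (Sum.inl g⁻¹) (Sum.inr x) (Sum.inr y)
  rw [dual_inl, inv_inv, hyz] at h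
  rw [← h, N_inl_inr_inr E hstab]

end GroupExt

/-- An extension of a non-trivial group `G` by `T = {t₁, t₂}` with
`G^l_t = G` for all `t` and `t̄₁ = t₂` has fusion rules `t₁ × t₁ = a t₁ + b t₂`,
`t₂ × t₂ = b t₁ + a t₂`, `t₁ × t₂ = t₂ × t₁ = ∑ g + a t₁ + a t₂`, with
`b² − a² = |G|`. -/
theorem two_particle_nonselfdual_rules {G T : Type*} [Group G] [Fintype G] [DecidableEq G]
    [Fintype T] [DecidableEq T] [Nonempty T] [Nontrivial G]
    (t₁ t₂ : T) (hne : t₁ ≠ t₂) (hcover : ∀ t : T, t = t₁ ∨ t = t₂)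
    (E : GroupExt G T)
    (hstab : ∀ (g : G) (t : T), E.N (Sum.inl g) (Sum.inr t) (Sum.inr t) ≠ 0)
    (hnsd : E.dual (Sum.inr t₁) = Sum.inr t₂) :
    ∃ a b : ℕ,
      (∀ g : G, E.N (Sum.inr t₁) (Sum.inr t₁) (Sum.inl g) = 0) ∧
      E.N (Sum.inr t₁) (Sum.inr t₁) (Sum.inr t₁) = a ∧
      E.N (Sum.inr t₁) (Sum.inr t₁) (Sum.inr t₂) = b ∧
      (∀ g : G, E.N (Sum.inr t₂) (Sum.inr t₂) (Sum.inl g) = 0) ∧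
      E.N (Sum.inr t₂) (Sum.inr t₂) (Sum.inr t₁) = b ∧
      E.N (Sum.inr t₂) (Sum.inr t₂) (Sum.inr t₂) = a ∧
      (∀ g : G, E.N (Sum.inr t₁) (Sum.inr t₂) (Sum.inl g) = 1) ∧
      E.N (Sum.inr t₁) (Sum.inr t₂) (Sum.inr t₁) = a ∧
      E.N (Sum.inr t₁) (Sum.inr t₂) (Sum.inr t₂) = a ∧
      (∀ g : G, E.N (Sum.inr t₂) (Sum.inr t₁) (Sum.inl g) = 1) ∧
      E.N (Sum.inr t₂) (Sum.inr t₁) (Sum.inr t₁) = a ∧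
      E.N (Sum.inr t₂) (Sum.inr t₁) (Sum.inr t₂) = a ∧
      (b : ℤ) ^ 2 - (a : ℤ) ^ 2 = Fintype.card G := by
  have hnsd' : E.dual (Sum.inr t₂) = Sum.inr t₁ := by rw [← hnsd, E.dual_dual]
  have cyc (x y z : G ⊕ T) := E.N_cyclic x y z
  have c121 := cyc (Sum.inr t₁) (Sum.inr t₂) (Sum.inr t₁)
  have c112 := cyc (Sum.inr t₁) (Sum.inr t₁) (Sum.inr t₂)
  have c122 := cyc (Sum.inr t₁) (Sum.inr t₂) (Sum.inr t₂)
  have c212 := cyc (Sum.inr t₂) (Sum.inr t₁) (Sum.inr t₂)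
  have f111 := E.frob (Sum.inr t₁) (Sum.inr t₁) (Sum.inr t₁)
  have f112 := E.frob (Sum.inr t₁) (Sum.inr t₁) (Sum.inr t₂)
  have f121 := E.frob (Sum.inr t₁) (Sum.inr t₂) (Sum.inr t₁)
  have f122 := E.frob (Sum.inr t₁) (Sum.inr t₂) (Sum.inr t₂)
  simp only [hnsd, hnsd'] at c121 c112 c122 c212 f111 f112 f121 f122
  have g11 (g : G) := E.N_inr_inr_inl hstab g (x := t₁) hnsd
  have g21 (g : G) := E.N_inr_inr_inl hstab g (x := t₂) hnsd
  have g12 (g : G) := E.N_inr_inr_inl hstab g (x := t₁) hnsd'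
  have g22 (g : G) := E.N_inr_inr_inl hstab g (x := t₂) hnsd'
  simp only [hne, hne.symm, if_true, if_false] at g11 g12 g21 g22
  have hg (g : G) : E.N (Sum.inr t₁) (Sum.inl g) (Sum.inr t₁) = 1 := by
    rw [E.frob, hnsd, g21]
  have huniv : (Finset.univ : Finset T) = {t₁, t₂} := by
    ext t
    simpa using hcover t
  have hassoc := E.assoc (Sum.inr t₁) (Sum.inr t₁) (Sum.inr t₂) (Sum.inr t₁)
  simp only [Fintype.sum_sum_type, huniv, Finset.sum_pair hne, g11, g12, hg, zero_mul, mul_one,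
    Finset.sum_const_zero, Finset.sum_const, Finset.card_univ, smul_eq_mul, zero_add] at hassoc
  refine ⟨_, _, g11, rfl, rfl, g22, ?_, ?_, g12, ?_, ?_, g21, ?_, ?_, ?_⟩
  all_goals try lia
  have e1 : E.N (Sum.inr t₁) (Sum.inr t₂) (Sum.inr t₁) =
    E.N (Sum.inr t₁) (Sum.inr t₁) (Sum.inr t₁) := by lia
  have e2 : E.N (Sum.inr t₁) (Sum.inr t₂) (Sum.inr t₂) =
    E.N (Sum.inr t₁) (Sum.inr t₁) (Sum.inr t₁) := by lia
  have e3 : E.N (Sum.inr t₂) (Sum.inr t₂) (Sum.inr t₁) =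
    E.N (Sum.inr t₁) (Sum.inr t₁) (Sum.inr t₂) := by lia
  rw [e1, e2, e3] at hassoc
  zify at hassoc
  linear_combination hassoc
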